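/- For a lower semilinear diagonal δ ∈ 𝒟^LSL, the identity ξ(δ) = φ(δ) holds if and only if δ = u_a for some a ∈ [0,1]. -/

import Mathlib

open MeasureTheory Set

/-- A lower semilinear diagonal: nondecreasing, 2-Lipschitz on `[0,1]`, `δ 1 = 1`,
`t² ≤ δ t ≤ t` on `[0,1]`, `t ↦ δ t / t` nondecreasing on `(0,1]` and
`t ↦ δ t / t²` nonincreasing on `(0,1]`. -/
def IsLSL (δ : ℝ → ℝ) : Prop :=
  MonotoneOn δ (Icc 0 1) ∧
  LipschitzOnWith 2 δ (Icc 0 1) ∧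
  δ 1 = 1 ∧
  (∀ t ∈ Icc (0:ℝ) 1, t ^ 2 ≤ δ t ∧ δ t ≤ t) ∧
  MonotoneOn (fun t => δ t / t) (Ioc 0 1) ∧
  AntitoneOn (fun t => δ t / t ^ 2) (Ioc 0 1)

/-- Kendall's tau of the lower semilinear copula with diagonal `δ`. -/
noncomputable def tauLSL (δ : ℝ → ℝ) : ℝ := 4 * (∫ t in (0:ℝ)..1, (δ t) ^ 2 / t) - 1

/-- Spearman's rho of the lower semilinear copula with diagonal `δ`. -/
noncomputable def rhoLSL (δ : ℝ → ℝ) : ℝ := 12 * (∫ t in (0:ℝ)..1, t * δ t) - 3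

/-- Spearman's footrule of the lower semilinear copula with diagonal `δ`. -/
noncomputable def phiLSL (δ : ℝ → ℝ) : ℝ := 6 * (∫ t in (0:ℝ)..1, δ t) - 2

/-- Chatterjee's rank correlation of the lower semilinear copula with diagonal `δ`,
expressed through the a.e. derivative of `δ` (represented by `deriv δ`, which agrees
with the a.e. derivative almost everywhere since `δ` is Lipschitz on `[0,1]`). -/
noncomputable def xiLSL (δ : ℝ → ℝ) : ℝ :=
  tauLSL δ - 2 * ∫ t in (0:ℝ)..1,
    (t * deriv δ t - δ t) * (2 * δ t - t * deriv δ t) / t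

/-- The diagonal `u_a`: `u_a t = t²/a` for `t ≤ a`, `u_a t = t` otherwise (`u_0 t = t`). -/
noncomputable def uDiag (a : ℝ) (t : ℝ) : ℝ :=
  if a = 0 then t else if t ≤ a then t ^ 2 / a else t

/-- The diagonal `l_a`: `l_a t = a·t` for `t ≤ a`, `l_a t = t²` otherwise. -/
noncomputable def lDiag (a : ℝ) (t : ℝ) : ℝ := if t ≤ a then a * t else t ^ 2

/-- The integrand whose integral over `[0,1]` is half of the gap `φ(δ) - ξ(δ)`. -/
noncomputable def gapIntegrand (δ : ℝ → ℝ) (t : ℝ) : ℝ :=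
  (2 * δ t / t - deriv δ t) * (t * deriv δ t + t - 2 * δ t)

namespace IsLSL

variable {δ : ℝ → ℝ}

lemma absolutelyContinuousOnInterval (hδ : IsLSL δ) : AbsolutelyContinuousOnInterval δ 0 1 :=
  LipschitzOnWith.absolutelyContinuousOnInterval (K := 2) (by
    rw [uIcc_of_le zero_le_one]; exact hδ.2.1)

lemma continuousOn (hδ : IsLSL δ) : ContinuousOn δ (Icc 0 1) :=
  hδ.2.1.continuousOn

lemma sq_le (hδ : IsLSL δ) {t : ℝ} (ht : t ∈ Icc (0:ℝ) 1) : t ^ 2 ≤ δ t := (hδ.2.2.2.1 t ht).1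

lemma le_self (hδ : IsLSL δ) {t : ℝ} (ht : t ∈ Icc (0:ℝ) 1) : δ t ≤ t := (hδ.2.2.2.1 t ht).2

lemma map_zero (hδ : IsLSL δ) : δ 0 = 0 := by
  have h := hδ.2.2.2.1 0 (by simp)
  simp only [ne_eq, OfNat.ofNat_ne_zero, not_false_eq_true, zero_pow] at h
  exact le_antisymm h.2 h.1

lemma ae_differentiableAt (hδ : IsLSL δ) :
    ∀ᵐ t, t ∈ Ioo (0:ℝ) 1 → DifferentiableAt ℝ δ t := by
  filter_upwards [hδ.absolutelyContinuousOnInterval.ae_differentiableAt] with t h ht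
  exact h (by rw [uIcc_of_le zero_le_one]; exact Ioo_subset_Icc_self ht)

lemma norm_deriv_le (hδ : IsLSL δ) {t : ℝ} (ht : t ∈ Ioo (0:ℝ) 1) : ‖deriv δ t‖ ≤ 2 := by
  simpa using norm_deriv_le_of_lipschitzOn (Icc_mem_nhds ht.1 ht.2) hδ.2.1

lemma le_mul_deriv (hδ : IsLSL δ) {t : ℝ} (ht : t ∈ Ioo (0:ℝ) 1) (hd : DifferentiableAt ℝ δ t) :
    δ t ≤ t * deriv δ t := by
  have ht0 : 0 < t := ht.1
  have h := (hδ.2.2.2.2.1.mono (Ioo_subset_Ioc_self)).derivWithin_nonneg (x := t)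
  rw [derivWithin_of_mem_nhds (Ioo_mem_nhds ht.1 ht.2),
    (hd.hasDerivAt.fun_div (hasDerivAt_id' t) ht0.ne').deriv, le_div_iff₀ (by simpa using by positivity)]
    at h
  simp only [zero_mul, mul_one] at h
  linarith

lemma mul_deriv_le (hδ : IsLSL δ) {t : ℝ} (ht : t ∈ Ioo (0:ℝ) 1) (hd : DifferentiableAt ℝ δ t) :
    t * deriv δ t ≤ 2 * δ t := by
  have ht0 : 0 < t := ht.1
  have h := (hδ.2.2.2.2.2.mono (Ioo_subset_Ioc_self)).derivWithin_nonpos (x := t)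
  rw [derivWithin_of_mem_nhds (Ioo_mem_nhds ht.1 ht.2),
    (hd.hasDerivAt.fun_div (hasDerivAt_pow 2 t) (by positivity)).deriv,
    div_le_iff₀ (by positivity)] at h
  simp only [Nat.cast_ofNat, Nat.add_one_sub_one, pow_one, zero_mul] at h
  have h' : t * (t * deriv δ t) ≤ t * (2 * δ t) := by linarith
  exact le_of_mul_le_mul_left h' ht0

lemma gapIntegrand_nonneg (hδ : IsLSL δ) {t : ℝ} (ht : t ∈ Ioo (0:ℝ) 1)
    (hd : DifferentiableAt ℝ δ t) : 0 ≤ gapIntegrand δ t := by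
  have h₁ := hδ.le_mul_deriv ht hd
  have h₂ := hδ.mul_deriv_le ht hd
  have h₃ := hδ.le_self (Ioo_subset_Icc_self ht)
  refine mul_nonneg ?_ (by linarith)
  rw [sub_nonneg, le_div_iff₀ ht.1]
  linarith

lemma intervalIntegrable_deriv_mul_deriv (hδ : IsLSL δ) :
    IntervalIntegrable (fun t => deriv δ t * deriv δ t) volume 0 1 := by
  have h := hδ.absolutelyContinuousOnInterval.intervalIntegrable_deriv
  rw [intervalIntegrable_iff_integrableOn_Ioo_of_le zero_le_one] at h ⊢
  refine h.bdd_mul (c := 2) h.aestronglyMeasurable ?_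
  filter_upwards [ae_restrict_mem measurableSet_Ioo] with t ht using hδ.norm_deriv_le ht

lemma intervalIntegrable_sq_div (hδ : IsLSL δ) :
    IntervalIntegrable (fun t => δ t ^ 2 / t) volume 0 1 := by
  have h : IntervalIntegrable δ volume 0 1 :=
    hδ.absolutelyContinuousOnInterval.continuousOn.intervalIntegrable
  rw [intervalIntegrable_iff_integrableOn_Ioo_of_le zero_le_one] at h ⊢
  have h' : IntegrableOn (fun t => δ t / t * δ t) (Ioo 0 1) := by
    refine h.bdd_mul (c := 1) (ContinuousOn.aestronglyMeasurable (ContinuousOn.div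
      (hδ.continuousOn.mono Ioo_subset_Icc_self) continuousOn_id fun t ht => ht.1.ne')
        measurableSet_Ioo) ?_
    filter_upwards [ae_restrict_mem measurableSet_Ioo] with t ht
    have h₁ := hδ.sq_le (Ioo_subset_Icc_self ht)
    have h₂ := hδ.le_self (Ioo_subset_Icc_self ht)
    have h₃ : 0 ≤ δ t := (sq_nonneg t).trans h₁
    rw [norm_div, Real.norm_of_nonneg h₃, Real.norm_of_nonneg ht.1.le, div_le_one ht.1]
    exact h₂
  exact h'.congr (Filter.Eventually.of_forall fun t => by ring)

lemma intervalIntegrable_deriv_mul_add (hδ : IsLSL δ) :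
    IntervalIntegrable (fun t => t * deriv δ t + δ t - δ t * deriv δ t) volume 0 1 := by
  have hac := hδ.absolutelyContinuousOnInterval
  exact ((hac.intervalIntegrable_deriv.continuousOn_mul continuousOn_id).add
    hac.continuousOn.intervalIntegrable).sub
    (hac.intervalIntegrable_deriv.continuousOn_mul hac.continuousOn)

lemma integral_deriv_mul_add (hδ : IsLSL δ) :
    ∫ t in (0:ℝ)..1, (t * deriv δ t + δ t - δ t * deriv δ t) = 1 / 2 := by
  have hac := hδ.absolutelyContinuousOnInterval
  have hid : AbsolutelyContinuousOnInterval (fun t : ℝ => t) 0 1 :=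
    contDiffOn_id.absolutelyContinuousOnInterval
  have h := ((hid.fun_mul hac).sub ((hac.fun_mul hac).const_mul (1 / 2))).integral_deriv_eq_sub
  have hcongr : ∫ t in (0:ℝ)..1, (t * deriv δ t + δ t - δ t * deriv δ t) =
      ∫ t in (0:ℝ)..1, deriv ((fun t => t * δ t) - fun t => 1 / 2 * (δ t * δ t)) t := by
    refine intervalIntegral.integral_congr_ae ?_
    filter_upwards [hac.ae_differentiableAt] with t hd ht
    have hd' := (hd (uIoc_subset_uIcc ht)).hasDerivAt
    rw [(((hasDerivAt_id' t).fun_mul hd').sub ((hd'.fun_mul hd').const_mul (1 / 2))).deriv]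
    ring
  rw [hcongr, h]
  simp [hδ.map_zero, hδ.2.2.1]
  norm_num

lemma intervalIntegrable_gapIntegrand (hδ : IsLSL δ) :
    IntervalIntegrable (gapIntegrand δ) volume 0 1 := by
  have hac := hδ.absolutelyContinuousOnInterval
  have hd := hac.intervalIntegrable_deriv
  have h := ((((hd.continuousOn_mul hac.continuousOn).const_mul 4).add
    (hac.continuousOn.intervalIntegrable.const_mul 2)).sub
    (hδ.intervalIntegrable_sq_div.const_mul 4)).sub
    ((hδ.intervalIntegrable_deriv_mul_deriv.continuousOn_mul continuousOn_id).add
      (hd.continuousOn_mul continuousOn_id))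
  refine h.congr fun t ht => ?_
  rw [uIoc_of_le zero_le_one] at ht
  have ht0 : t ≠ 0 := ht.1.ne'
  simp only [gapIntegrand, id]
  field_simp
  ring

/-- The gap between the footrule and Chatterjee's coefficient, as a single integral. -/
lemma phi_sub_xi (hδ : IsLSL δ) :
    phiLSL δ - xiLSL δ = 2 * ∫ t in (0:ℝ)..1, gapIntegrand δ t := by
  have hac := hδ.absolutelyContinuousOnInterval
  have hcongr : ∫ t in (0:ℝ)..1, (t * deriv δ t - δ t) * (2 * δ t - t * deriv δ t) / t =
      ∫ t in (0:ℝ)..1, (gapIntegrand δ t - 3 * δ t + 2 * (δ t ^ 2 / t) +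
        (t * deriv δ t + δ t - δ t * deriv δ t)) := by
    refine intervalIntegral.integral_congr_ae (Filter.Eventually.of_forall fun t ht => ?_)
    rw [uIoc_of_le zero_le_one] at ht
    have ht0 : t ≠ 0 := ht.1.ne'
    simp only [gapIntegrand]
    field_simp
    ring
  have hi := hδ.intervalIntegrable_gapIntegrand
  have hi₁ := (hac.continuousOn.intervalIntegrable (μ := volume)).const_mul 3
  have hi₂ := hδ.intervalIntegrable_sq_div.const_mul 2
  rw [intervalIntegral.integral_add ((hi.sub hi₁).add hi₂) hδ.intervalIntegrable_deriv_mul_add,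
    intervalIntegral.integral_add (hi.sub hi₁) hi₂, intervalIntegral.integral_sub hi hi₁,
    intervalIntegral.integral_const_mul, intervalIntegral.integral_const_mul,
    hδ.integral_deriv_mul_add] at hcongr
  rw [phiLSL, xiLSL, tauLSL, hcongr]
  ring

lemma xi_eq_phi_iff_gapIntegrand_ae (hδ : IsLSL δ) :
    xiLSL δ = phiLSL δ ↔ ∀ᵐ t, t ∈ Ioo (0:ℝ) 1 → gapIntegrand δ t = 0 := by
  have h : xiLSL δ = phiLSL δ ↔ ∫ t in (0:ℝ)..1, gapIntegrand δ t = 0 := by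
    have := hδ.phi_sub_xi
    constructor <;> intro h' <;> linarith
  have hi := hδ.intervalIntegrable_gapIntegrand
  rw [intervalIntegrable_iff_integrableOn_Ioo_of_le zero_le_one] at hi
  rw [h, intervalIntegral.integral_of_le zero_le_one, integral_Ioc_eq_integral_Ioo,
    integral_eq_zero_iff_of_nonneg_ae _ hi, Filter.EventuallyEq, ae_restrict_iff' measurableSet_Ioo]
  · rfl
  · rw [Filter.EventuallyLE, ae_restrict_iff' measurableSet_Ioo]
    filter_upwards [hδ.ae_differentiableAt] with t hd ht using hδ.gapIntegrand_nonneg ht (hd ht)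

/-- Where the diagonal stays below the identity, a vanishing gap forces it to be a multiple
of the square. -/
lemma div_sq_eq_of_gapIntegrand_ae (hδ : IsLSL δ)
    (h : ∀ᵐ t, t ∈ Ioo (0:ℝ) 1 → gapIntegrand δ t = 0) {s b : ℝ} (hs : 0 < s) (hsb : s ≤ b)
    (hb : b ≤ 1) (hlt : ∀ t ∈ Ioo s b, δ t < t) : δ s / s ^ 2 = δ b / b ^ 2 := by
  have hsub : uIcc s b ⊆ uIcc 0 1 := by
    rw [uIcc_of_le hsb, uIcc_of_le zero_le_one]
    exact Icc_subset_Icc hs.le hb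
  have hac := hδ.absolutelyContinuousOnInterval.mono hsub
  have hinv : AbsolutelyContinuousOnInterval (fun t : ℝ => (t ^ 2)⁻¹) s b := by
    refine ContDiffOn.absolutelyContinuousOnInterval ((contDiffOn_id.pow 2).inv fun t ht => ?_)
    rw [uIcc_of_le hsb] at ht
    have : 0 < t := hs.trans_le ht.1
    simpa using this.ne'
  have hint := (hac.fun_mul hinv).integral_deriv_eq_sub
  have hzero : ∫ t in s..b, deriv (fun t => δ t * (t ^ 2)⁻¹) t = ∫ t in s..b, (0 : ℝ) := by
    refine intervalIntegral.integral_congr_ae ?_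
    filter_upwards [h, hδ.ae_differentiableAt, Measure.ae_ne volume b] with t hgap hd htb ht
    rw [uIoc_of_le hsb] at ht
    have ht0 : 0 < t := hs.trans ht.1
    have htb' : t < b := lt_of_le_of_ne ht.2 htb
    have ht1 : t ∈ Ioo (0:ℝ) 1 := ⟨ht0, htb'.trans_le hb⟩
    have h₁ := hδ.le_mul_deriv ht1 (hd ht1)
    have h₂ := hlt t ⟨ht.1, htb'⟩
    have h₃ : 2 * δ t / t - deriv δ t = 0 := by
      rcases mul_eq_zero.1 (hgap ht1) with h' | h'
      · exact h'
      · linarith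
    have h₄ : deriv δ t = 2 * δ t / t := by linarith
    rw [((hd ht1).hasDerivAt.fun_mul ((hasDerivAt_pow 2 t).fun_inv (by positivity))).deriv, h₄]
    simp only [Nat.cast_ofNat, Nat.add_one_sub_one, pow_one]
    field_simp
    ring
  rw [hint, intervalIntegral.integral_zero] at hzero
  rw [div_eq_mul_inv, div_eq_mul_inv]
  linarith

/-- The fixed points of a lower semilinear diagonal form an upper set. -/
lemma eq_self_of_le (hδ : IsLSL δ) {s t : ℝ} (hs : 0 < s) (hst : s ≤ t) (ht : t ≤ 1)
    (h : δ s = s) : δ t = t := by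
  have ht0 : 0 < t := hs.trans_le hst
  have hm : δ s / s ≤ δ t / t := hδ.2.2.2.2.1 ⟨hs, hst.trans ht⟩ ⟨ht0, ht⟩ hst
  rw [h, div_self hs.ne', one_le_div ht0] at hm
  exact le_antisymm (hδ.le_self ⟨ht0.le, ht⟩) hm

lemma exists_eq_uDiag (hδ : IsLSL δ) (h : ∀ᵐ t, t ∈ Ioo (0:ℝ) 1 → gapIntegrand δ t = 0) :
    ∃ a ∈ Icc (0:ℝ) 1, ∀ t ∈ Icc (0:ℝ) 1, δ t = uDiag a t := by
  set S : Set ℝ := {t | t ∈ Ioc (0:ℝ) 1 ∧ δ t = t}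
  have h1S : (1:ℝ) ∈ S := ⟨by simp, hδ.2.2.1⟩
  have hbdd : BddBelow S := ⟨0, fun t ht => ht.1.1.le⟩
  have ha0 : 0 ≤ sInf S := le_csInf ⟨1, h1S⟩ fun t ht => ht.1.1.le
  have ha1 : sInf S ≤ 1 := csInf_le hbdd h1S
  have habove : ∀ t ∈ Icc (0:ℝ) 1, sInf S < t → δ t = t := by
    intro t ht hat
    obtain ⟨s, hs, hst⟩ := (csInf_lt_iff hbdd ⟨1, h1S⟩).1 hat
    exact hδ.eq_self_of_le hs.1.1 hst.le ht.2 hs.2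
  have hfix : δ (sInf S) = sInf S := by
    have hclosed : IsClosed {t | t ∈ Icc (0:ℝ) 1 ∧ δ t = t} :=
      isClosed_Icc.isClosed_eq hδ.continuousOn continuousOn_id
    have hsub : S ⊆ {t | t ∈ Icc (0:ℝ) 1 ∧ δ t = t} :=
      fun t ht => ⟨Ioc_subset_Icc_self ht.1, ht.2⟩
    exact (closure_minimal hsub hclosed (csInf_mem_closure ⟨1, h1S⟩ hbdd)).2
  refine ⟨sInf S, ⟨ha0, ha1⟩, fun t ht => ?_⟩
  unfold uDiag
  split_ifs with hz hta
  · rcases ht.1.eq_or_lt with rfl | ht0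
    · exact hδ.map_zero
    · exact habove t ht (hz ▸ ht0)
  · rcases ht.1.eq_or_lt with rfl | ht0
    · simp [hδ.map_zero]
    · have heq := hδ.div_sq_eq_of_gapIntegrand_ae h ht0 hta ha1 fun x hx => by
        have hx' : x ∈ Ioc (0:ℝ) 1 := ⟨ht0.trans hx.1, hx.2.le.trans ha1⟩
        refine lt_of_le_of_ne (hδ.le_self (Ioc_subset_Icc_self hx')) fun hxx => ?_
        exact absurd (csInf_le hbdd (show x ∈ S from ⟨hx', hxx⟩)) (not_le.2 hx.2)
      rw [hfix, div_eq_div_iff (by positivity) (by positivity)] at heq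
      rw [eq_div_iff hz]
      exact mul_right_cancel₀ hz (by linarith)
  · exact habove t ht (not_le.1 hta)

lemma gapIntegrand_ae_of_eq_uDiag {a : ℝ}
    (h : ∀ t ∈ Icc (0:ℝ) 1, δ t = uDiag a t) :
    ∀ᵐ t, t ∈ Ioo (0:ℝ) 1 → gapIntegrand δ t = 0 := by
  filter_upwards [Measure.ae_ne volume a] with t hta ht
  have hmem := Ioo_subset_Icc_self ht
  have hev : δ =ᶠ[nhds t] uDiag a := by
    filter_upwards [Icc_mem_nhds ht.1 ht.2] with x hx using h x hx
  have ht0 : t ≠ 0 := ht.1.ne'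
  by_cases hsq : a ≠ 0 ∧ t < a
  · have hev' : δ =ᶠ[nhds t] fun x => x ^ 2 / a := by
      filter_upwards [hev, Iio_mem_nhds hsq.2] with x hx hxa
      rw [hx, uDiag, if_neg hsq.1, if_pos (le_of_lt hxa)]
    have ha := hsq.1
    have hd : deriv δ t = 2 * t / a := by
      rw [hev'.deriv_eq, ((hasDerivAt_pow 2 t).div_const a).deriv]
      simp
    rw [gapIntegrand, hd, hev'.eq_of_nhds]
    field_simp
    ring
  · have hev' : δ =ᶠ[nhds t] id := by
      by_cases ha : a = 0
      · filter_upwards [hev] with x hx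
        rw [hx, uDiag, if_pos ha, id]
      · have hat : a < t := lt_of_le_of_ne (not_lt.1 fun h' => hsq ⟨ha, h'⟩) hta.symm
        filter_upwards [hev, Ioi_mem_nhds hat] with x hx hxa
        rw [hx, uDiag, if_neg ha, if_neg (not_le.2 hxa), id]
    rw [gapIntegrand, hev'.deriv_eq, hev'.eq_of_nhds, deriv_id, id]
    ring

end IsLSL

/-- `ξ(δ) = φ(δ)` holds iff `δ = u_a` for some `a ∈ [0,1]`. -/
theorem xi_eq_phi_iff (δ : ℝ → ℝ) (hδ : IsLSL δ) :
    xiLSL δ = phiLSL δ ↔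
    ∃ a ∈ Icc (0:ℝ) 1, ∀ t ∈ Icc (0:ℝ) 1, δ t = uDiag a t := by
  rw [hδ.xi_eq_phi_iff_gapIntegrand_ae]
  exact ⟨hδ.exists_eq_uDiag, fun ⟨_, _, h⟩ => IsLSL.gapIntegrand_ae_of_eq_uDiag h⟩
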